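/- Fix integers M ≥ 1, N ≥ 0, j ≥ 0 and let ω := exp(2πi/M). On the N-photon sector H_{M,N} := EuclideanSpace ℂ over {n : ZMod M → ℕ // ∑_m n(m) = N}, with X̂ e_n = e_{X·n} for (X·n)(m) := n(m−1) and Ẑ e_n = ω^{μ(n)} e_n for μ(n) := ∑_{m∈ZMod M} n(m)·m, the Heisenberg–Weyl operator Λ̂_j := X̂ ∘ Ẑ^j satisfies Λ̂_j^M = ω^{j·N·M·(M−1)/2} · id. In particular, if M is odd then Λ̂_j^M = id. -/

import Mathlib

noncomputable section

/-- The `N`-photon sector of an `M`-mode multi-rail system: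
Fock vectors `n : ZMod M → ℕ` with total photon number `N`. -/
def Fock (M N : ℕ) [NeZero M] : Type :=
  {n : ZMod M → ℕ // ∑ m : ZMod M, n m = N}

/-- The cyclic mode shift on Fock vectors, `(X·n)(m) = n(m-1)`. -/
def Fock.shift {M N : ℕ} [NeZero M] (n : Fock M N) : Fock M N :=
  ⟨fun m => n.1 (m - 1),
    (Fintype.sum_equiv (Equiv.subRight (1 : ZMod M))
      (fun m => n.1 (m - 1)) n.1 (fun _ => rfl)).trans n.2⟩

/-- The Z-clock label `μ(n) = ∑ m, n(m)·m ∈ ZMod M` of a Fock vector. -/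
def Fock.mu {M N : ℕ} [NeZero M] (n : Fock M N) : ZMod M :=
  ∑ m : ZMod M, (n.1 m : ZMod M) * m

theorem pow_eq_pow_of_cast_eq {M : ℕ} {R : Type*} [Monoid R] {w : R} (hw : w ^ M = 1) {a b : ℕ}
    (h : (a : ZMod M) = b) : w ^ a = w ^ b :=
  pow_eq_pow_of_modEq ((ZMod.natCast_eq_natCast_iff a b M).1 h) hw

theorem Fock.mu_shift {M N : ℕ} [NeZero M] (n : Fock M N) : n.shift.mu = n.mu + N := by
  have h : n.shift.mu = ∑ m : ZMod M, (n.1 m : ZMod M) * (m + 1) :=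
    Fintype.sum_equiv (Equiv.subRight (1 : ZMod M)) _ _ (fun m => by simp [Fock.shift])
  have hN : ∑ m : ZMod M, (n.1 m : ZMod M) = N := by
    rw [← Nat.cast_sum, n.2]
  rw [h, Fock.mu, ← hN, ← Finset.sum_add_distrib]
  exact Finset.sum_congr rfl fun m _ => by ring

theorem Fock.mu_shift_iterate {M N : ℕ} [NeZero M] (n : Fock M N) (k : ℕ) :
    (Fock.shift^[k] n).mu = n.mu + k * N := by
  induction k with
  | zero => simp
  | succ k ih =>
    rw [Function.iterate_succ_apply', Fock.mu_shift, ih]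
    push_cast
    ring

theorem Fock.shift_iterate_apply {M N : ℕ} [NeZero M] (n : Fock M N) (k : ℕ) (m : ZMod M) :
    (Fock.shift^[k] n).1 m = n.1 (m - k) := by
  induction k generalizing m with
  | zero => simp
  | succ k ih =>
    rw [Function.iterate_succ_apply']
    change (Fock.shift^[k] n).1 (m - 1) = _
    rw [ih, Nat.cast_succ, sub_sub, add_comm (1 : ZMod M)]

theorem Fock.shift_iterate_modes {M N : ℕ} [NeZero M] (n : Fock M N) :
    Fock.shift^[M] n = n :=
  Subtype.ext (funext fun m => by simp [Fock.shift_iterate_apply])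

/-- Powers of `X Z ^ j` on Fock states, for any clock phase `w` with `w ^ M = 1`. -/
theorem heisenbergWeyl_pow_single {M N : ℕ} [NeZero M] [Fintype (Fock M N)]
    [DecidableEq (Fock M N)] {w : ℂ} (hw : w ^ M = 1)
    {X Z : Module.End ℂ (EuclideanSpace ℂ (Fock M N))}
    (hX : ∀ n : Fock M N,
      X (EuclideanSpace.single n 1) = EuclideanSpace.single n.shift 1)
    (hZ : ∀ n : Fock M N,
      Z (EuclideanSpace.single n 1) = w ^ (Fock.mu n).val • EuclideanSpace.single n 1)
    (j k : ℕ) (n : Fock M N) :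
    ((X ∘ₗ Z ^ j) ^ k) (EuclideanSpace.single n 1) =
      w ^ (j * (k * n.mu.val + N * ∑ i ∈ Finset.range k, i)) •
        EuclideanSpace.single (Fock.shift^[k] n) 1 := by
  have hZj (n : Fock M N) : (Z ^ j) (EuclideanSpace.single n 1) =
      w ^ (j * n.mu.val) • EuclideanSpace.single n 1 := by
    induction j with
    | zero => simp
    | succ j ih =>
      rw [pow_succ', Module.End.mul_apply, ih, map_smul, hZ, smul_smul, ← pow_add]
      congr 2
      ring
  induction k with
  | zero => simp
  | succ k ih =>
    rw [pow_succ', Module.End.mul_apply, ih, map_smul, LinearMap.comp_apply, hZj, map_smul, hX,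
      smul_smul, ← pow_add, Function.iterate_succ_apply']
    congr 1
    apply pow_eq_pow_of_cast_eq hw
    rw [Finset.sum_range_succ]
    push_cast
    rw [ZMod.natCast_zmod_val, ZMod.natCast_zmod_val, Fock.mu_shift_iterate]
    ring

theorem stmt12 (M N j : ℕ) (hM : 1 ≤ M) [NeZero M]
    [Fintype (Fock M N)] [DecidableEq (Fock M N)]
    (ω : ℂ) (hω : ω = Complex.exp (2 * Real.pi * Complex.I / M))
    (X Z : Module.End ℂ (EuclideanSpace ℂ (Fock M N)))
    (hX : ∀ n : Fock M N,
      X (EuclideanSpace.single n 1) = EuclideanSpace.single n.shift 1)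
    (hZ : ∀ n : Fock M N,
      Z (EuclideanSpace.single n 1) = ω ^ (Fock.mu n).val • EuclideanSpace.single n 1) :
    (X ∘ₗ Z ^ j) ^ M =
      ω ^ (j * N * (M * (M - 1) / 2)) • (1 : Module.End ℂ (EuclideanSpace ℂ (Fock M N))) ∧
    (Odd M → (X ∘ₗ Z ^ j) ^ M = 1) := by
  have hw : ω ^ M = 1 := by
    rw [hω]
    exact (Complex.isPrimitiveRoot_exp M (NeZero.ne M)).pow_eq_one
  have key : (X ∘ₗ Z ^ j) ^ M =
      ω ^ (j * N * (M * (M - 1) / 2)) •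
        (1 : Module.End ℂ (EuclideanSpace ℂ (Fock M N))) := by
    refine (EuclideanSpace.basisFun (Fock M N) ℂ).toBasis.ext fun n => ?_
    rw [OrthonormalBasis.coe_toBasis, EuclideanSpace.basisFun_apply,
      heisenbergWeyl_pow_single hw hX hZ, Fock.shift_iterate_modes, LinearMap.smul_apply,
      Module.End.one_apply, Finset.sum_range_id]
    congr 1
    apply pow_eq_pow_of_cast_eq hw
    push_cast
    rw [ZMod.natCast_self]
    ring
  refine ⟨key, fun hodd => ?_⟩
  obtain ⟨t, ht⟩ := hodd
  have ht' : M * (M - 1) / 2 = M * t := by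
    rw [show M - 1 = t * 2 by omega, ← mul_assoc, Nat.mul_div_cancel _ two_pos]
  rw [key, ht', mul_left_comm, pow_mul, hw, one_pow, one_smul]
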